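/- arXiv:1505.04182 — 9 statements merged into one kernel-verified Lean document; each statement's English description precedes it below -/
import Mathlib

section
/- The Funk function φ(r,s) = (√(1 − (r² − s²)) + s)/(1 − r²) satisfies the linear PDE s·φ_{rs}(r,s) + r·φ_{ss}(r,s) − φ_r(r,s) = 0 at every point (r,s) with 0 < r < 1 and s² ≤ r². (Equivalently, the quantity Q associated to the Funk metric vanishes identically.) -/
open Real

/-- Partial derivative in the first variable. -/
noncomputable def pd1 (f : ℝ → ℝ → ℝ) (r s : ℝ) : ℝ := deriv (fun t => f t s) r

/-- Partial derivative in the second variable. -/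
noncomputable def pd2 (f : ℝ → ℝ → ℝ) (r s : ℝ) : ℝ := deriv (fun t => f r t) s

/-- The Funk function φ(r,s) = (√(1 − (r² − s²)) + s)/(1 − r²). -/
noncomputable def funkPhi : ℝ → ℝ → ℝ :=
  fun r s => (Real.sqrt (1 - (r ^ 2 - s ^ 2)) + s) / (1 - r ^ 2)

lemma hasDerivAt_sqrt_fst {r s : ℝ} (h : 0 < 1 - (r ^ 2 - s ^ 2)) :
    HasDerivAt (fun t => √(1 - (t ^ 2 - s ^ 2))) (-r / √(1 - (r ^ 2 - s ^ 2))) r := by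
  have h₀ : HasDerivAt (fun t : ℝ => 1 - (t ^ 2 - s ^ 2)) (-(2 * r)) r := by
    simpa using (((hasDerivAt_id r).pow 2).sub_const (s ^ 2)).const_sub 1
  convert h₀.sqrt h.ne' using 1
  rw [← mul_neg, mul_div_mul_left _ _ two_ne_zero]

lemma hasDerivAt_sqrt_snd {r s : ℝ} (h : 0 < 1 - (r ^ 2 - s ^ 2)) :
    HasDerivAt (fun t => √(1 - (r ^ 2 - t ^ 2))) (s / √(1 - (r ^ 2 - s ^ 2))) s := by
  have h₀ : HasDerivAt (fun t : ℝ => 1 - (r ^ 2 - t ^ 2)) (2 * s) s := by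
    simpa using (((hasDerivAt_id s).pow 2).const_sub (r ^ 2)).const_sub 1
  convert h₀.sqrt h.ne' using 1
  rw [mul_div_mul_left _ _ two_ne_zero]

lemma hasDerivAt_one_sub_sq (r : ℝ) : HasDerivAt (fun t : ℝ => 1 - t ^ 2) (-(2 * r)) r := by
  simpa using ((hasDerivAt_id r).pow 2).const_sub 1

lemma pd2_funkPhi {r s : ℝ} (h : 0 < 1 - (r ^ 2 - s ^ 2)) :
    pd2 funkPhi r s = (s / √(1 - (r ^ 2 - s ^ 2)) + 1) / (1 - r ^ 2) :=
  (((hasDerivAt_sqrt_snd h).add (hasDerivAt_id s)).div_const _).deriv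

lemma pd1_funkPhi {r s : ℝ} (h : 0 < 1 - (r ^ 2 - s ^ 2)) (hr : 1 - r ^ 2 ≠ 0) :
    pd1 funkPhi r s =
      (-r / √(1 - (r ^ 2 - s ^ 2)) * (1 - r ^ 2) -
        (√(1 - (r ^ 2 - s ^ 2)) + s) * -(2 * r)) / (1 - r ^ 2) ^ 2 :=
  (((hasDerivAt_sqrt_fst h).add_const s).div (hasDerivAt_one_sub_sq r) hr).deriv

lemma pd1_pd2_funkPhi {r s : ℝ} (h : 0 < 1 - (r ^ 2 - s ^ 2)) (hr : 1 - r ^ 2 ≠ 0) :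
    pd1 (pd2 funkPhi) r s =
      (s * (r / √(1 - (r ^ 2 - s ^ 2)) ^ 3) * (1 - r ^ 2) -
        (s / √(1 - (r ^ 2 - s ^ 2)) + 1) * -(2 * r)) / (1 - r ^ 2) ^ 2 := by
  have hA : √(1 - (r ^ 2 - s ^ 2)) ≠ 0 := (sqrt_pos.2 h).ne'
  have he : (fun t => pd2 funkPhi t s) =ᶠ[nhds r]
      fun t => (s / √(1 - (t ^ 2 - s ^ 2)) + 1) / (1 - t ^ 2) := by
    have hc : Continuous fun t : ℝ => 1 - (t ^ 2 - s ^ 2) := by fun_prop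
    filter_upwards [hc.continuousAt.eventually (lt_mem_nhds h)] with t ht using pd2_funkPhi ht
  have hq : HasDerivAt (fun t => s / √(1 - (t ^ 2 - s ^ 2)))
      (s * (r / √(1 - (r ^ 2 - s ^ 2)) ^ 3)) r := by
    refine ((hasDerivAt_const r s).div (hasDerivAt_sqrt_fst h) hA).congr_deriv ?_
    field_simp
    ring
  exact he.deriv_eq.trans ((hq.add_const 1).div (hasDerivAt_one_sub_sq r) hr).deriv

lemma pd2_pd2_funkPhi {r s : ℝ} (h : 0 < 1 - (r ^ 2 - s ^ 2)) (hr : 1 - r ^ 2 ≠ 0) :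
    pd2 (pd2 funkPhi) r s = 1 / √(1 - (r ^ 2 - s ^ 2)) ^ 3 := by
  have hA : √(1 - (r ^ 2 - s ^ 2)) ≠ 0 := (sqrt_pos.2 h).ne'
  have hA2 : √(1 - (r ^ 2 - s ^ 2)) ^ 2 = 1 - (r ^ 2 - s ^ 2) := sq_sqrt h.le
  have he : (fun t => pd2 funkPhi r t) =ᶠ[nhds s]
      fun t => (t / √(1 - (r ^ 2 - t ^ 2)) + 1) / (1 - r ^ 2) := by
    have hc : Continuous fun t : ℝ => 1 - (r ^ 2 - t ^ 2) := by fun_prop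
    filter_upwards [hc.continuousAt.eventually (lt_mem_nhds h)] with t ht using pd2_funkPhi ht
  refine (he.deriv_eq.trans ((((hasDerivAt_id s).div (hasDerivAt_sqrt_snd h) hA).add_const
    1).div_const _).deriv).trans ?_
  simp only [id]
  generalize √(1 - (r ^ 2 - s ^ 2)) = A at *
  field_simp
  linear_combination hA2

/-- The Funk function satisfies s·φ_{rs} + r·φ_{ss} − φ_r = 0 (i.e. Q ≡ 0). -/
theorem funk_satisfies_Q_zero (r s : ℝ) (hr0 : 0 < r) (hr1 : r < 1) (hs : s ^ 2 ≤ r ^ 2) :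
    s * pd1 (pd2 funkPhi) r s + r * pd2 (pd2 funkPhi) r s - pd1 funkPhi r s = 0 := by
  have hD : 0 < 1 - r ^ 2 := by nlinarith
  have h : 0 < 1 - (r ^ 2 - s ^ 2) := by nlinarith [sq_nonneg s]
  rw [pd1_pd2_funkPhi h hD.ne', pd2_pd2_funkPhi h hD.ne', pd1_funkPhi h hD.ne']
  have hA : √(1 - (r ^ 2 - s ^ 2)) ≠ 0 := (sqrt_pos.2 h).ne'
  have hA2 : √(1 - (r ^ 2 - s ^ 2)) ^ 2 = 1 - (r ^ 2 - s ^ 2) := sq_sqrt h.le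
  have hD' := hD.ne'
  generalize √(1 - (r ^ 2 - s ^ 2)) = A at *
  have hr2 : 1 - r ^ 2 = A ^ 2 - s ^ 2 := by linarith
  rw [hr2] at hD' ⊢
  field_simp
  ring
end

section
/- Let φ(r,s) = (√(1 − (r² − s²)) + s)/(1 − r²) (the Funk function) and set ψ(r,s) := (s·φ_r(r,s) + r·φ_s(r,s))/(2r·φ(r,s)). Then at every point (r,s) with 0 < r < 1 and s² ≤ r², one has −(1/4)·φ(r,s)² = ψ(r,s)² − (s·ψ_r(r,s) + r·ψ_s(r,s))/r. (This is the constant–flag–curvature equation R₁ = Kφ² with K = −1/4 for the Funk metric.) -/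
open Real

/-- ψ := (s·φ_r + r·φ_s)/(2rφ). -/
noncomputable def psiFun (φ : ℝ → ℝ → ℝ) (r s : ℝ) : ℝ :=
  (s * pd1 φ r s + r * pd2 φ r s) / (2 * r * φ r s)

theorem one_sub_sq_pos {r : ℝ} (hr0 : 0 < r) (hr1 : r < 1) : 0 < 1 - r ^ 2 := by nlinarith

theorem funk_radicand_pos {r : ℝ} (s : ℝ) (hr0 : 0 < r) (hr1 : r < 1) :
    0 < 1 - (r ^ 2 - s ^ 2) := by
  nlinarith [one_sub_sq_pos hr0 hr1, sq_nonneg s]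

theorem funkPhi_pos {r : ℝ} (s : ℝ) (hr0 : 0 < r) (hr1 : r < 1) : 0 < funkPhi r s := by
  have h : -s < √(1 - (r ^ 2 - s ^ 2)) :=
    Real.lt_sqrt_of_sq_lt (by nlinarith [one_sub_sq_pos hr0 hr1])
  exact div_pos (by linarith) (one_sub_sq_pos hr0 hr1)

theorem hasDerivAt_funkPhi_left {r : ℝ} (s : ℝ) (hr0 : 0 < r) (hr1 : r < 1) :
    HasDerivAt (fun t => funkPhi t s)
      (-(r / (√(1 - (r ^ 2 - s ^ 2)) * (1 - r ^ 2))) +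
        2 * r * (√(1 - (r ^ 2 - s ^ 2)) + s) / (1 - r ^ 2) ^ 2) r := by
  have hR := Real.sqrt_pos.2 (funk_radicand_pos s hr0 hr1)
  have hd := one_sub_sq_pos hr0 hr1
  have hsq := (hasDerivAt_id r).pow 2
  have h := ((((hsq.sub_const (s ^ 2)).const_sub 1).sqrt
    (funk_radicand_pos s hr0 hr1).ne').add_const s).div (hsq.const_sub 1) hd.ne'
  refine h.congr_deriv ?_
  simp only [id, Pi.pow_apply]
  field_simp
  norm_num

theorem hasDerivAt_funkPhi_right {r : ℝ} (s : ℝ) (hr0 : 0 < r) (hr1 : r < 1) :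
    HasDerivAt (fun t => funkPhi r t)
      ((s / √(1 - (r ^ 2 - s ^ 2)) + 1) / (1 - r ^ 2)) s := by
  have hR := Real.sqrt_pos.2 (funk_radicand_pos s hr0 hr1)
  have hd := one_sub_sq_pos hr0 hr1
  have h := (((((hasDerivAt_id s).pow 2).const_sub (r ^ 2)).const_sub 1).sqrt
    (funk_radicand_pos s hr0 hr1).ne').add (hasDerivAt_id s) |>.div_const (1 - r ^ 2)
  refine h.congr_deriv ?_
  simp only [id, Pi.pow_apply]
  field_simp
  norm_num
  ring

theorem funkPhi_transport {r : ℝ} (s : ℝ) (hr0 : 0 < r) (hr1 : r < 1) :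
    s * pd1 funkPhi r s + r * pd2 funkPhi r s = r * funkPhi r s ^ 2 := by
  have hp := funk_radicand_pos s hr0 hr1
  have hR := Real.sqrt_pos.2 hp
  have hd := one_sub_sq_pos hr0 hr1
  have hsq := Real.sq_sqrt hp.le
  rw [pd1, pd2, (hasDerivAt_funkPhi_left s hr0 hr1).deriv,
    (hasDerivAt_funkPhi_right s hr0 hr1).deriv, funkPhi]
  set R := √(1 - (r ^ 2 - s ^ 2))
  field_simp
  linear_combination -R * hsq

theorem psiFun_funkPhi {r : ℝ} (s : ℝ) (hr0 : 0 < r) (hr1 : r < 1) :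
    psiFun funkPhi r s = funkPhi r s / 2 := by
  have := funkPhi_pos s hr0 hr1
  rw [psiFun, funkPhi_transport s hr0 hr1]
  field_simp

/-- The Funk metric has constant flag curvature K = −1/4: R₁ = Kφ². -/
theorem funk_constant_curvature (r s : ℝ) (hr0 : 0 < r) (hr1 : r < 1) (hs : s ^ 2 ≤ r ^ 2) :
    -(1 / 4) * (funkPhi r s) ^ 2 =
      (psiFun funkPhi r s) ^ 2
        - (s * pd1 (psiFun funkPhi) r s + r * pd2 (psiFun funkPhi) r s) / r := by
  have h1 : pd1 (psiFun funkPhi) r s = pd1 funkPhi r s / 2 := by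
    have h : (fun t => psiFun funkPhi t s) =ᶠ[nhds r] fun t => funkPhi t s / 2 := by
      filter_upwards [Ioo_mem_nhds hr0 hr1] with t ht using psiFun_funkPhi s ht.1 ht.2
    rw [pd1, h.deriv_eq, deriv_div_const, pd1]
  have h2 : pd2 (psiFun funkPhi) r s = pd2 funkPhi r s / 2 := by
    simp only [pd2, psiFun_funkPhi _ hr0 hr1, deriv_div_const]
  rw [h1, h2, psiFun_funkPhi s hr0 hr1]
  field_simp
  linear_combination 8 * funkPhi_transport s hr0 hr1
end

section
/- The Berwald function φ(r,s) = (√(1 − (r² − s²)) + s)² / ((1 − r²)²·√(1 − (r² − s²))) satisfies the linear PDE s·φ_{rs}(r,s) + r·φ_{ss}(r,s) − φ_r(r,s) = 0 at every point (r,s) with 0 < r < 1 and s² ≤ r². -/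
open Real

/-- The Berwald function φ(r,s) = (√(1 − (r² − s²)) + s)²/((1 − r²)²·√(1 − (r² − s²))). -/
noncomputable def berwaldPhi : ℝ → ℝ → ℝ :=
  fun r s => (Real.sqrt (1 - (r ^ 2 - s ^ 2)) + s) ^ 2 /
    ((1 - r ^ 2) ^ 2 * Real.sqrt (1 - (r ^ 2 - s ^ 2)))

lemma hasDerivAt_one_sub_sq_sq (r : ℝ) :
    HasDerivAt (fun t : ℝ => (1 - t ^ 2) ^ 2) (-4 * r * (1 - r ^ 2)) r := by
  refine (((hasDerivAt_pow 2 r).const_sub 1).pow 2).congr_deriv ?_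
  norm_num
  ring

/-- The first `s`-derivative of the Berwald function, in closed form. -/
lemma pd2_berwaldPhi {r s : ℝ} (hr : r ^ 2 < 1) :
    pd2 berwaldPhi r s = (2 + 3 * (s / √(1 - (r ^ 2 - s ^ 2))) -
      (s / √(1 - (r ^ 2 - s ^ 2))) ^ 3) / (1 - r ^ 2) ^ 2 := by
  have h : 0 < 1 - (r ^ 2 - s ^ 2) := by nlinarith [sq_nonneg s]
  have hw := Real.sqrt_pos.2 h
  have hD : 1 - r ^ 2 ≠ 0 := by linarith
  have hd := hasDerivAt_sqrt_snd h
  have := ((hd.add (hasDerivAt_id' s)).pow 2).div (hd.const_mul ((1 - r ^ 2) ^ 2))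
    (mul_ne_zero (pow_ne_zero 2 hD) hw.ne')
  refine this.deriv.trans ?_
  simp only [Pi.add_apply, Pi.pow_apply, Nat.cast_ofNat, Nat.add_one_sub_one, pow_one]
  generalize √(1 - (r ^ 2 - s ^ 2)) = w at hw
  field_simp
  ring

/-- The second `s`-derivative of the Berwald function, in closed form. -/
lemma pd2_pd2_berwaldPhi {r s : ℝ} (hr : r ^ 2 < 1) :
    pd2 (pd2 berwaldPhi) r s = 3 / √(1 - (r ^ 2 - s ^ 2)) ^ 5 := by
  have h : 0 < 1 - (r ^ 2 - s ^ 2) := by nlinarith [sq_nonneg s]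
  have hw := Real.sqrt_pos.2 h
  have hw2 := Real.sq_sqrt h.le
  have hD : 1 - r ^ 2 ≠ 0 := by linarith
  have hu := (hasDerivAt_id' s).div (hasDerivAt_sqrt_snd h) hw.ne'
  have := (((hu.const_mul 3).const_add 2).sub (hu.pow 3)).div_const ((1 - r ^ 2) ^ 2)
  rw [pd2, funext fun t => pd2_berwaldPhi (s := t) hr]
  refine this.deriv.trans ?_
  simp only [Pi.div_apply, Nat.cast_ofNat, Nat.add_one_sub_one]
  generalize √(1 - (r ^ 2 - s ^ 2)) = w at hw hw2
  have hDw : 1 - r ^ 2 = w ^ 2 - s ^ 2 := by linarith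
  rw [hDw] at hD ⊢
  field_simp

/-- The mixed derivative of the Berwald function, in closed form. -/
lemma pd1_pd2_berwaldPhi {r s : ℝ} (hr : r ^ 2 < 1) :
    pd1 (pd2 berwaldPhi) r s = 3 * s * r / (√(1 - (r ^ 2 - s ^ 2)) ^ 5 * (1 - r ^ 2)) +
      4 * r * (2 + 3 * (s / √(1 - (r ^ 2 - s ^ 2))) -
        (s / √(1 - (r ^ 2 - s ^ 2))) ^ 3) / (1 - r ^ 2) ^ 3 := by
  have h : 0 < 1 - (r ^ 2 - s ^ 2) := by nlinarith [sq_nonneg s]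
  have hw := Real.sqrt_pos.2 h
  have hw2 := Real.sq_sqrt h.le
  have hD : 1 - r ^ 2 ≠ 0 := by linarith
  have hu := (hasDerivAt_const r s).div (hasDerivAt_sqrt_fst h) hw.ne'
  have := (((hu.const_mul 3).const_add 2).sub (hu.pow 3)).div (hasDerivAt_one_sub_sq_sq r)
    (pow_ne_zero 2 hD)
  have hev : (fun t => pd2 berwaldPhi t s) =ᶠ[nhds r] _ :=
    ((continuous_pow 2).continuousAt.eventually_lt continuousAt_const hr).mono
      fun t ht => pd2_berwaldPhi (r := t) (s := s) ht
  refine hev.deriv_eq.trans (this.deriv.trans ?_)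
  simp only [Pi.div_apply, Pi.sub_apply, Pi.pow_apply, Nat.cast_ofNat, Nat.add_one_sub_one]
  generalize √(1 - (r ^ 2 - s ^ 2)) = w at hw hw2
  have hDw : 1 - r ^ 2 = w ^ 2 - s ^ 2 := by linarith
  rw [hDw] at hD ⊢
  field_simp
  ring

/-- The `r`-derivative of the Berwald function, in closed form. -/
lemma pd1_berwaldPhi {r s : ℝ} (hr : r ^ 2 < 1) :
    pd1 berwaldPhi r s = -r / (√(1 - (r ^ 2 - s ^ 2)) ^ 3 * (1 - r ^ 2)) +
      4 * r * (√(1 - (r ^ 2 - s ^ 2)) + s) ^ 2 /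
        (√(1 - (r ^ 2 - s ^ 2)) * (1 - r ^ 2) ^ 3) := by
  have h : 0 < 1 - (r ^ 2 - s ^ 2) := by nlinarith [sq_nonneg s]
  have hw := Real.sqrt_pos.2 h
  have hw2 := Real.sq_sqrt h.le
  have hD : 1 - r ^ 2 ≠ 0 := by linarith
  have hd := hasDerivAt_sqrt_fst h
  have := ((hd.add_const s).pow 2).div ((hasDerivAt_one_sub_sq_sq r).mul hd)
    (mul_ne_zero (pow_ne_zero 2 hD) hw.ne')
  refine this.deriv.trans ?_
  simp only [Pi.mul_apply, Pi.pow_apply, Nat.cast_ofNat, Nat.add_one_sub_one, pow_one]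
  generalize √(1 - (r ^ 2 - s ^ 2)) = w at hw hw2
  have hDw : 1 - r ^ 2 = w ^ 2 - s ^ 2 := by linarith
  rw [hDw] at hD ⊢
  field_simp
  ring

/-- The Berwald function satisfies s·φ_{rs} + r·φ_{ss} − φ_r = 0 (i.e. Q ≡ 0). -/
theorem berwald_satisfies_Q_zero (r s : ℝ) (hr0 : 0 < r) (hr1 : r < 1) (hs : s ^ 2 ≤ r ^ 2) :
    s * pd1 (pd2 berwaldPhi) r s + r * pd2 (pd2 berwaldPhi) r s - pd1 berwaldPhi r s = 0 := by
  have hr : r ^ 2 < 1 := by nlinarith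
  rw [pd1_pd2_berwaldPhi hr, pd2_pd2_berwaldPhi hr, pd1_berwaldPhi hr]
  have h : 0 < 1 - (r ^ 2 - s ^ 2) := by nlinarith [sq_nonneg s]
  have hw := Real.sqrt_pos.2 h
  have hw2 := Real.sq_sqrt h.le
  have hD : 1 - r ^ 2 ≠ 0 := by linarith
  generalize √(1 - (r ^ 2 - s ^ 2)) = w at hw hw2
  have hDw : 1 - r ^ 2 = w ^ 2 - s ^ 2 := by linarith
  rw [hDw] at hD ⊢
  field_simp
  ring
end

section
/- Fix a constant ε with −1 ≤ ε < 1, and let φ(r,s) = (1/2)·[ (√(1 − (r² − s²)) + s)/(1 − r²) − ε·(√(1 − ε²(r² − s²)) + εs)/(1 − ε²r²) ]. Then φ satisfies the linear PDE s·φ_{rs}(r,s) + r·φ_{ss}(r,s) − φ_r(r,s) = 0 at every point (r,s) with 0 < r < 1 and s² ≤ r². -/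
open Real

/-- Shen's function φ(r,s) depending on the parameter ε. -/
noncomputable def shenPhi (ε : ℝ) : ℝ → ℝ → ℝ :=
  fun r s => (1 / 2) * ((Real.sqrt (1 - (r ^ 2 - s ^ 2)) + s) / (1 - r ^ 2)
    - ε * (Real.sqrt (1 - ε ^ 2 * (r ^ 2 - s ^ 2)) + ε * s) / (1 - ε ^ 2 * r ^ 2))

theorem shen_radicand_pos {e r : ℝ} (h : e ^ 2 * r ^ 2 < 1) (s : ℝ) :
    0 < 1 - e ^ 2 * (r ^ 2 - s ^ 2) := by
  nlinarith [mul_nonneg (sq_nonneg e) (sq_nonneg s)]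

theorem hasDerivAt_shen_sqrt_fst {e r : ℝ} (h : e ^ 2 * r ^ 2 < 1) (s : ℝ) :
    HasDerivAt (fun t => √(1 - e ^ 2 * (t ^ 2 - s ^ 2)))
      (-(e ^ 2 * r) / √(1 - e ^ 2 * (r ^ 2 - s ^ 2))) r := by
  have := (((((hasDerivAt_id r).pow 2).sub_const (s ^ 2)).const_mul (e ^ 2)).const_sub 1).sqrt
    (shen_radicand_pos h s).ne'
  convert this using 1
  simp only [Pi.pow_apply, id]
  field_simp
  norm_num
  ring

theorem hasDerivAt_shen_sqrt_snd {e r : ℝ} (h : e ^ 2 * r ^ 2 < 1) (s : ℝ) :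
    HasDerivAt (fun t => √(1 - e ^ 2 * (r ^ 2 - t ^ 2)))
      (e ^ 2 * s / √(1 - e ^ 2 * (r ^ 2 - s ^ 2))) s := by
  have := (((((hasDerivAt_id s).pow 2).const_sub (r ^ 2)).const_mul (e ^ 2)).const_sub 1).sqrt
    (shen_radicand_pos h s).ne'
  convert this using 1
  simp only [Pi.pow_apply, id]
  field_simp
  norm_num
  ring

theorem hasDerivAt_shen_denom (e r : ℝ) :
    HasDerivAt (fun t => 1 - e ^ 2 * t ^ 2) (-(2 * e ^ 2 * r)) r := by
  refine ((((hasDerivAt_id r).pow 2).const_mul (e ^ 2)).const_sub 1).congr_deriv ?_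
  simp only [id]
  norm_num
  ring

/-- The building block of Shen's function: `φ` is half the difference of its values at `1`
and at `ε`. -/
noncomputable def shenTerm (e r s : ℝ) : ℝ :=
  e * (√(1 - e ^ 2 * (r ^ 2 - s ^ 2)) + e * s) / (1 - e ^ 2 * r ^ 2)

/-- The derivative of `shenTerm` in its last variable. -/
noncomputable def shenTermSnd (e r s : ℝ) : ℝ :=
  e * (e ^ 2 * s / √(1 - e ^ 2 * (r ^ 2 - s ^ 2)) + e) / (1 - e ^ 2 * r ^ 2)

theorem shenPhi_eq_shenTerm (ε r s : ℝ) :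
    shenPhi ε r s = (1 / 2) * (shenTerm 1 r s - shenTerm ε r s) := by
  simp [shenPhi, shenTerm]

theorem hasDerivAt_shenTerm_snd {e r : ℝ} (h : e ^ 2 * r ^ 2 < 1) (s : ℝ) :
    HasDerivAt (fun t => shenTerm e r t) (shenTermSnd e r s) s := by
  refine ((((hasDerivAt_shen_sqrt_snd h s).add
    ((hasDerivAt_id s).const_mul e)).const_mul e).div_const (1 - e ^ 2 * r ^ 2)).congr_deriv ?_
  simp [shenTermSnd]

theorem shenTerm_satisfies_Q_zero {e r : ℝ} (h : e ^ 2 * r ^ 2 < 1) (s : ℝ) :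
    ∃ a b c : ℝ, HasDerivAt (fun t => shenTermSnd e t s) a r ∧
      HasDerivAt (fun t => shenTermSnd e r t) b s ∧
      HasDerivAt (fun t => shenTerm e t s) c r ∧ s * a + r * b - c = 0 := by
  have hA := shen_radicand_pos h s
  have hR := Real.sqrt_pos.2 hA
  have hD : 1 - e ^ 2 * r ^ 2 ≠ 0 := by linarith
  refine ⟨_, _, _,
    (((((hasDerivAt_const r (e ^ 2 * s)).div (hasDerivAt_shen_sqrt_fst h s) hR.ne').add_const
      e).const_mul e).div (hasDerivAt_shen_denom e r) hD),
    (((((hasDerivAt_id s).const_mul (e ^ 2)).div (hasDerivAt_shen_sqrt_snd h s) hR.ne').add_const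
      e).const_mul e).div_const (1 - e ^ 2 * r ^ 2),
    ((((hasDerivAt_shen_sqrt_fst h s).add_const (e * s)).const_mul e).div
      (hasDerivAt_shen_denom e r) hD), ?_⟩
  have hsq := Real.sq_sqrt hA.le
  simp only [id, Pi.div_apply]
  generalize √(1 - e ^ 2 * (r ^ 2 - s ^ 2)) = R at *
  have hR0 := hR.ne'
  obtain ⟨D, hD'⟩ : ∃ D, D = 1 - e ^ 2 * r ^ 2 := ⟨_, rfl⟩
  rw [← hD'] at hD ⊢
  have hRD : R ^ 2 = D + e ^ 2 * s ^ 2 := by rw [hsq, hD']; ring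
  have hDR : D = R ^ 2 - e ^ 2 * s ^ 2 := by linarith
  field_simp
  rw [hDR]
  ring

/-- Shen's function satisfies s·φ_{rs} + r·φ_{ss} − φ_r = 0 (i.e. Q ≡ 0). -/
theorem shen_satisfies_Q_zero (ε : ℝ) (hε1 : -1 ≤ ε) (hε2 : ε < 1)
    (r s : ℝ) (hr0 : 0 < r) (hr1 : r < 1) (hs : s ^ 2 ≤ r ^ 2) :
    s * pd1 (pd2 (shenPhi ε)) r s + r * pd2 (pd2 (shenPhi ε)) r s - pd1 (shenPhi ε) r s = 0 := by
  have h1 : ∀ t : ℝ, |t| < 1 → (1 : ℝ) ^ 2 * t ^ 2 < 1 := fun t ht => by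
    simpa using (sq_lt_one_iff_abs_lt_one t).2 ht
  have hε : ∀ t : ℝ, |t| < 1 → ε ^ 2 * t ^ 2 < 1 := fun t ht => by
    have hε_sq : ε ^ 2 ≤ 1 := by nlinarith
    nlinarith [h1 t ht, mul_nonneg (sub_nonneg.2 hε_sq) (sq_nonneg t)]
  have hr : |r| < 1 := by rwa [abs_of_pos hr0]
  have hsnd : ∀ t u : ℝ, |t| < 1 →
      pd2 (shenPhi ε) t u = (1 / 2) * (shenTermSnd 1 t u - shenTermSnd ε t u) := fun t u ht => by
    simp only [pd2, shenPhi_eq_shenTerm]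
    exact (((hasDerivAt_shenTerm_snd (h1 t ht) u).sub
      (hasDerivAt_shenTerm_snd (hε t ht) u)).const_mul _).deriv
  obtain ⟨a, b, c, ha, hb, hc, H⟩ := shenTerm_satisfies_Q_zero (h1 r hr) s
  obtain ⟨a', b', c', ha', hb', hc', H'⟩ := shenTerm_satisfies_Q_zero (hε r hr) s
  have e1 : pd1 (pd2 (shenPhi ε)) r s = (1 / 2) * (a - a') := by
    refine (((ha.sub ha').const_mul (1 / 2)).congr_of_eventuallyEq ?_).deriv
    filter_upwards [continuous_abs.continuousAt.eventually_lt_const hr] with t ht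
    exact hsnd t s ht
  have e2 : pd2 (pd2 (shenPhi ε)) r s = (1 / 2) * (b - b') := by
    rw [pd2]
    simp only [hsnd r _ hr]
    exact ((hb.sub hb').const_mul _).deriv
  have e3 : pd1 (shenPhi ε) r s = (1 / 2) * (c - c') := by
    simp only [pd1, shenPhi_eq_shenTerm]
    exact ((hc.sub hc').const_mul _).deriv
  rw [e1, e2, e3]
  linear_combination (1 / 2) * H - (1 / 2) * H'
end

section
/- Fix a constant ε with −1 ≤ ε < 1, let φ(r,s) = (1/2)·[ (√(1 − (r² − s²)) + s)/(1 − r²) − ε·(√(1 − ε²(r² − s²)) + εs)/(1 − ε²r²) ], and set ψ(r,s) := (s·φ_r(r,s) + r·φ_s(r,s))/(2r·φ(r,s)). Then at every point (r,s) with 0 < r < 1 and s² ≤ r² (where φ > 0), one has −φ(r,s)² = ψ(r,s)² − (s·ψ_r(r,s) + r·ψ_s(r,s))/r. (This is the constant–flag–curvature equation R₁ = Kφ² with K = −1 for Shen's metrics.) -/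
open Real

open Filter Topology

/-- The building block of Shen's function, equal to `c / (√(1 - c²(r² - s²)) - c s)`. -/
noncomputable def shenBlock (c r s : ℝ) : ℝ :=
  c * (Real.sqrt (1 - c ^ 2 * (r ^ 2 - s ^ 2)) + c * s) / (1 - c ^ 2 * r ^ 2)

lemma shenPhi_eq_shenBlock (ε r s : ℝ) :
    shenPhi ε r s = (shenBlock 1 r s - shenBlock ε r s) / 2 := by
  simp only [shenPhi, shenBlock, one_pow, one_mul]
  ring

lemma one_sub_sq_mul_sq_pos {c r : ℝ} (hc : c ^ 2 ≤ 1) (hr0 : 0 < r) (hr1 : r < 1) :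
    0 < 1 - c ^ 2 * r ^ 2 := by
  nlinarith [mul_le_mul_of_nonneg_right hc (sq_nonneg r)]

lemma one_sub_sq_mul_sub_pos {c r : ℝ} (hc : c ^ 2 ≤ 1) (hr0 : 0 < r) (hr1 : r < 1) (s : ℝ) :
    0 < 1 - c ^ 2 * (r ^ 2 - s ^ 2) := by
  nlinarith [one_sub_sq_mul_sq_pos hc hr0 hr1, mul_nonneg (sq_nonneg c) (sq_nonneg s)]

lemma hasDerivAt_shenBlock_fst {c r : ℝ} (hc : c ^ 2 ≤ 1) (hr0 : 0 < r) (hr1 : r < 1) (s : ℝ) :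
    HasDerivAt (fun t => shenBlock c t s)
      ((c * (-(c ^ 2 * (2 * r)) / (2 * Real.sqrt (1 - c ^ 2 * (r ^ 2 - s ^ 2))))
          * (1 - c ^ 2 * r ^ 2)
        - c * (Real.sqrt (1 - c ^ 2 * (r ^ 2 - s ^ 2)) + c * s) * -(c ^ 2 * (2 * r)))
        / (1 - c ^ 2 * r ^ 2) ^ 2) r := by
  have hsq : HasDerivAt (fun t : ℝ => t ^ 2) (2 * r) r := by
    simpa using hasDerivAt_pow 2 r
  exact ((((((hsq.sub_const (s ^ 2)).const_mul (c ^ 2)).const_sub 1).sqrt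
    (one_sub_sq_mul_sub_pos hc hr0 hr1 s).ne').add_const (c * s)).const_mul c).div
    ((hsq.const_mul (c ^ 2)).const_sub 1) (one_sub_sq_mul_sq_pos hc hr0 hr1).ne'

lemma hasDerivAt_shenBlock_snd {c r : ℝ} (hc : c ^ 2 ≤ 1) (hr0 : 0 < r) (hr1 : r < 1) (s : ℝ) :
    HasDerivAt (fun t => shenBlock c r t)
      (c * (-(c ^ 2 * -(2 * s)) / (2 * Real.sqrt (1 - c ^ 2 * (r ^ 2 - s ^ 2))) + c * 1)
        / (1 - c ^ 2 * r ^ 2)) s := by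
  have hsq : HasDerivAt (fun t : ℝ => t ^ 2) (2 * s) s := by
    simpa using hasDerivAt_pow 2 s
  exact ((((((hsq.const_sub (r ^ 2)).const_mul (c ^ 2)).const_sub 1).sqrt
    (one_sub_sq_mul_sub_pos hc hr0 hr1 s).ne').add
    ((hasDerivAt_id s).const_mul c)).const_mul c).div_const _

/-- The block solves the Riccati equation `(s ∂_r + r ∂_s) w = r w²`. -/
lemma shenBlock_riccati {c r : ℝ} (hc : c ^ 2 ≤ 1) (hr0 : 0 < r) (hr1 : r < 1) (s : ℝ) :
    s * pd1 (shenBlock c) r s + r * pd2 (shenBlock c) r s = r * shenBlock c r s ^ 2 := by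
  rw [pd1, pd2, (hasDerivAt_shenBlock_fst hc hr0 hr1 s).deriv,
    (hasDerivAt_shenBlock_snd hc hr0 hr1 s).deriv, shenBlock]
  have hpos := one_sub_sq_mul_sub_pos hc hr0 hr1 s
  have hden := (one_sub_sq_mul_sq_pos hc hr0 hr1).ne'
  have hB := (Real.sqrt_pos.2 hpos).ne'
  have hBsq := Real.sq_sqrt hpos.le
  set B := Real.sqrt (1 - c ^ 2 * (r ^ 2 - s ^ 2))
  have hD : 1 - c ^ 2 * r ^ 2 = B ^ 2 - c ^ 2 * s ^ 2 := by rw [hBsq]; ring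
  rw [hD] at hden ⊢
  field_simp
  ring

lemma hasDerivAt_shenPhi_fst {ε r : ℝ} (hε : ε ^ 2 ≤ 1) (hr0 : 0 < r) (hr1 : r < 1) (s : ℝ) :
    HasDerivAt (fun t => shenPhi ε t s) ((pd1 (shenBlock 1) r s - pd1 (shenBlock ε) r s) / 2) r := by
  simp only [shenPhi_eq_shenBlock]
  exact ((hasDerivAt_shenBlock_fst (by norm_num) hr0 hr1 s).differentiableAt.hasDerivAt.sub
    (hasDerivAt_shenBlock_fst hε hr0 hr1 s).differentiableAt.hasDerivAt).div_const 2

lemma hasDerivAt_shenPhi_snd {ε r : ℝ} (hε : ε ^ 2 ≤ 1) (hr0 : 0 < r) (hr1 : r < 1) (s : ℝ) :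
    HasDerivAt (fun t => shenPhi ε r t) ((pd2 (shenBlock 1) r s - pd2 (shenBlock ε) r s) / 2) s := by
  simp only [shenPhi_eq_shenBlock]
  exact ((hasDerivAt_shenBlock_snd (by norm_num) hr0 hr1 s).differentiableAt.hasDerivAt.sub
    (hasDerivAt_shenBlock_snd hε hr0 hr1 s).differentiableAt.hasDerivAt).div_const 2

lemma psiFun_shenPhi {ε r s : ℝ} (hε : ε ^ 2 ≤ 1) (hr0 : 0 < r) (hr1 : r < 1)
    (hφ : shenPhi ε r s ≠ 0) :
    psiFun (shenPhi ε) r s = (shenBlock 1 r s + shenBlock ε r s) / 2 := by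
  have h1 := shenBlock_riccati (c := 1) (by norm_num) hr0 hr1 s
  have h2 := shenBlock_riccati hε hr0 hr1 s
  have e1 : pd1 (shenPhi ε) r s = _ := (hasDerivAt_shenPhi_fst hε hr0 hr1 s).deriv
  have e2 : pd2 (shenPhi ε) r s = _ := (hasDerivAt_shenPhi_snd hε hr0 hr1 s).deriv
  rw [psiFun, e1, e2, div_eq_iff (by positivity), shenPhi_eq_shenBlock]
  linear_combination (h1 - h2) / 2

/-- Shen's metrics have constant flag curvature K = −1: R₁ = −φ². -/
theorem shen_constant_curvature (ε : ℝ) (hε1 : -1 ≤ ε) (hε2 : ε < 1)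
    (r s : ℝ) (hr0 : 0 < r) (hr1 : r < 1) (hs : s ^ 2 ≤ r ^ 2)
    (hpos : 0 < shenPhi ε r s) :
    -(shenPhi ε r s) ^ 2 =
      (psiFun (shenPhi ε) r s) ^ 2
        - (s * pd1 (psiFun (shenPhi ε)) r s + r * pd2 (psiFun (shenPhi ε)) r s) / r := by
  have hε : ε ^ 2 ≤ 1 := by nlinarith
  have hψ1 : (fun t => psiFun (shenPhi ε) t s) =ᶠ[𝓝 r]
      fun t => (shenBlock 1 t s + shenBlock ε t s) / 2 := by
    filter_upwards [(hasDerivAt_shenPhi_fst hε hr0 hr1 s).continuousAt.eventually_ne hpos.ne',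
      Ioo_mem_nhds hr0 hr1] with t ht htr
    exact psiFun_shenPhi hε htr.1 htr.2 ht
  have hψ2 : (fun t => psiFun (shenPhi ε) r t) =ᶠ[𝓝 s]
      fun t => (shenBlock 1 r t + shenBlock ε r t) / 2 := by
    filter_upwards [(hasDerivAt_shenPhi_snd hε hr0 hr1 s).continuousAt.eventually_ne hpos.ne'] with t ht
    exact psiFun_shenPhi hε hr0 hr1 ht
  have e1 : pd1 (psiFun (shenPhi ε)) r s
      = (pd1 (shenBlock 1) r s + pd1 (shenBlock ε) r s) / 2 :=
    hψ1.deriv_eq.trans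
      (((hasDerivAt_shenBlock_fst (by norm_num) hr0 hr1 s).differentiableAt.hasDerivAt.add
        (hasDerivAt_shenBlock_fst hε hr0 hr1 s).differentiableAt.hasDerivAt).div_const 2).deriv
  have e2 : pd2 (psiFun (shenPhi ε)) r s
      = (pd2 (shenBlock 1) r s + pd2 (shenBlock ε) r s) / 2 :=
    hψ2.deriv_eq.trans
      (((hasDerivAt_shenBlock_snd (by norm_num) hr0 hr1 s).differentiableAt.hasDerivAt.add
        (hasDerivAt_shenBlock_snd hε hr0 hr1 s).differentiableAt.hasDerivAt).div_const 2).deriv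
  have h1 := shenBlock_riccati (c := 1) (by norm_num) hr0 hr1 s
  have h2 := shenBlock_riccati hε hr0 hr1 s
  have hX : (s * pd1 (psiFun (shenPhi ε)) r s + r * pd2 (psiFun (shenPhi ε)) r s) / r
      = (shenBlock 1 r s ^ 2 + shenBlock ε r s ^ 2) / 2 := by
    rw [e1, e2, div_eq_iff hr0.ne']
    linear_combination (h1 + h2) / 2
  rw [hX, psiFun_shenPhi hε hr0 hr1 hpos.ne', shenPhi_eq_shenBlock]
  ring
end

section
/- Let Φ: U → ℝ be a smooth positive function on an open set U ⊆ ℝ² (coordinates (u,v)), let K ∈ ℝ, and define φ(r,s) := Φ(r² − s², s) and ψ(r,s) := (s·φ_r(r,s) + r·φ_s(r,s))/(2r·φ(r,s)) for r ≠ 0. Then for any point (r,s) with r ≠ 0 and (r² − s², s) ∈ U, the equation K·φ(r,s)² = ψ(r,s)² − (s·ψ_r(r,s) + r·ψ_s(r,s))/r holds at (r,s) if and only if the ordinary differential equation (in the variable v) K·Φ² = (Φ_v/(2Φ))² − ∂_v(Φ_v/(2Φ)) holds at the point (r² − s², s). -/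
open Real

/-- The substitution φ(r,s) := Φ(r² − s², s). -/
noncomputable def substPhi (Φ : ℝ → ℝ → ℝ) : ℝ → ℝ → ℝ :=
  fun r s => Φ (r ^ 2 - s ^ 2) s

open Filter Topology

theorem pd2_eq_fderiv {f : ℝ → ℝ → ℝ} {a b : ℝ}
    (hf : DifferentiableAt ℝ (fun p : ℝ × ℝ => f p.1 p.2) (a, b)) :
    pd2 f a b = fderiv ℝ (fun p : ℝ × ℝ => f p.1 p.2) (a, b) (0, 1) :=
  (hf.hasFDerivAt.comp_hasDerivAt_of_eq b
    ((hasDerivAt_const b a).prodMk (hasDerivAt_id b)) rfl).deriv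

/-- The vector field `s ∂_r + r ∂_s` becomes `r ∂_v` under `u = r² - s²`, `v = s`. -/
theorem mul_pd1_add_mul_pd2_substPhi {f : ℝ → ℝ → ℝ} {r s : ℝ}
    (hf : DifferentiableAt ℝ (fun p : ℝ × ℝ => f p.1 p.2) (r ^ 2 - s ^ 2, s)) :
    s * pd1 (substPhi f) r s + r * pd2 (substPhi f) r s = r * pd2 f (r ^ 2 - s ^ 2) s := by
  have h1 : pd1 (substPhi f) r s =
      fderiv ℝ (fun p : ℝ × ℝ => f p.1 p.2) (r ^ 2 - s ^ 2, s) (2 * r, 0) := by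
    have h : HasDerivAt (fun t : ℝ => (t ^ 2 - s ^ 2, s)) (2 * r, 0) r := by
      refine HasDerivAt.prodMk ?_ (hasDerivAt_const r s)
      simpa using (hasDerivAt_pow 2 r).sub_const (s ^ 2)
    exact (hf.hasFDerivAt.comp_hasDerivAt_of_eq r h rfl).deriv
  have h2 : pd2 (substPhi f) r s =
      fderiv ℝ (fun p : ℝ × ℝ => f p.1 p.2) (r ^ 2 - s ^ 2, s) (-(2 * s), 1) := by
    have h : HasDerivAt (fun t : ℝ => (r ^ 2 - t ^ 2, t)) (-(2 * s), 1) s := by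
      refine HasDerivAt.prodMk ?_ (hasDerivAt_id s)
      simpa using (hasDerivAt_pow 2 s).const_sub (r ^ 2)
    exact (hf.hasFDerivAt.comp_hasDerivAt_of_eq s h rfl).deriv
  have hv : ((0, r) : ℝ × ℝ) = s • (2 * r, 0) + r • (-(2 * s), 1) := by
    ext <;> simp
    ring
  have hw : ((0, r) : ℝ × ℝ) = r • (0, 1) := by simp
  rw [h1, h2, pd2_eq_fderiv hf, ← smul_eq_mul s, ← smul_eq_mul r, ← smul_eq_mul r, ← map_smul,
    ← map_smul, ← map_smul, ← map_add, ← hv, ← hw]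

theorem psiFun_substPhi {f : ℝ → ℝ → ℝ} {r s : ℝ} (hr : r ≠ 0)
    (hf : DifferentiableAt ℝ (fun p : ℝ × ℝ => f p.1 p.2) (r ^ 2 - s ^ 2, s)) :
    psiFun (substPhi f) r s = substPhi (fun u v => pd2 f u v / (2 * f u v)) r s := by
  rw [psiFun, mul_pd1_add_mul_pd2_substPhi hf, mul_comm 2 r, mul_assoc,
    mul_div_mul_left _ _ hr]
  rfl

theorem pd1_congr {f g : ℝ → ℝ → ℝ} {a b : ℝ}
    (h : ∀ᶠ p : ℝ × ℝ in 𝓝 (a, b), f p.1 p.2 = g p.1 p.2) : pd1 f a b = pd1 g a b := by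
  have hc : ContinuousAt (fun t : ℝ => (t, b)) a := by fun_prop
  exact EventuallyEq.deriv_eq (hc.eventually h)

theorem pd2_congr {f g : ℝ → ℝ → ℝ} {a b : ℝ}
    (h : ∀ᶠ p : ℝ × ℝ in 𝓝 (a, b), f p.1 p.2 = g p.1 p.2) : pd2 f a b = pd2 g a b := by
  have hc : ContinuousAt (fun t : ℝ => (a, t)) b := by fun_prop
  exact EventuallyEq.deriv_eq (hc.eventually h)

/-- Under the substitution u = r² − s², v = s, the constant flag curvature equation
Kφ² = ψ² − (sψ_r + rψ_s)/r reduces to the ODE KΦ² = (Φ_v/(2Φ))² − ∂_v(Φ_v/(2Φ)). -/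
theorem pdeM2_reduces_to_ODE (U : Set (ℝ × ℝ)) (hU : IsOpen U) (Φ : ℝ → ℝ → ℝ)
    (hΦ : ContDiffOn ℝ (⊤ : ℕ∞) (fun p : ℝ × ℝ => Φ p.1 p.2) U)
    (hΦpos : ∀ p ∈ U, 0 < Φ p.1 p.2) (K : ℝ) :
    ∀ r s : ℝ, r ≠ 0 → (r ^ 2 - s ^ 2, s) ∈ U →
      (K * (substPhi Φ r s) ^ 2 =
        (psiFun (substPhi Φ) r s) ^ 2
          - (s * pd1 (psiFun (substPhi Φ)) r s + r * pd2 (psiFun (substPhi Φ)) r s) / r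
      ↔ K * (Φ (r ^ 2 - s ^ 2) s) ^ 2 =
          (pd2 Φ (r ^ 2 - s ^ 2) s / (2 * Φ (r ^ 2 - s ^ 2) s)) ^ 2
            - pd2 (fun u v => pd2 Φ u v / (2 * Φ u v)) (r ^ 2 - s ^ 2) s) := by
  intro r s hr hU'
  have hdiff : ∀ p ∈ U, DifferentiableAt ℝ (fun p : ℝ × ℝ => Φ p.1 p.2) p := fun p hp =>
    (hΦ.contDiffAt (hU.mem_nhds hp)).differentiableAt (by simp)
  have hG : DifferentiableAt ℝ (fun p : ℝ × ℝ => pd2 Φ p.1 p.2 / (2 * Φ p.1 p.2))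
      (r ^ 2 - s ^ 2, s) := by
    have hF : DifferentiableAt ℝ (fderiv ℝ fun p : ℝ × ℝ => Φ p.1 p.2) (r ^ 2 - s ^ 2, s) :=
      ((hΦ.contDiffAt (hU.mem_nhds hU')).fderiv_right (m := (⊤ : ℕ∞)) le_rfl).differentiableAt
        (by simp)
    have hN : DifferentiableAt ℝ (fun p : ℝ × ℝ => pd2 Φ p.1 p.2) (r ^ 2 - s ^ 2, s) := by
      refine (hF.clm_apply (differentiableAt_const ((0, 1) : ℝ × ℝ))).congr_of_eventuallyEq ?_
      filter_upwards [hU.mem_nhds hU'] with p hp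
      exact pd2_eq_fderiv (hdiff p hp)
    have hD : DifferentiableAt ℝ (fun p : ℝ × ℝ => 2 * Φ p.1 p.2) (r ^ 2 - s ^ 2, s) :=
      (hdiff _ hU').const_mul 2
    simpa only [div_eq_mul_inv] using
      hN.fun_mul (hD.fun_inv (mul_ne_zero two_ne_zero (hΦpos _ hU').ne'))
  have hev : ∀ᶠ p : ℝ × ℝ in 𝓝 (r, s), psiFun (substPhi Φ) p.1 p.2 =
      substPhi (fun u v => pd2 Φ u v / (2 * Φ u v)) p.1 p.2 := by
    have hc : Continuous fun p : ℝ × ℝ => (p.1 ^ 2 - p.2 ^ 2, p.2) := by fun_prop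
    filter_upwards [hc.continuousAt.eventually (hU.mem_nhds hU'),
      continuous_fst.continuousAt.eventually_ne hr] with p hp hp0
    exact psiFun_substPhi hp0 (hdiff _ hp)
  rw [pd1_congr hev, pd2_congr hev, mul_pd1_add_mul_pd2_substPhi hG, mul_div_cancel_left₀ _ hr,
    psiFun_substPhi hr (hdiff _ hU')]
  rfl
end

section
/- Let K < 0 and C > 0 be constants, and define φ(r,s) := 1/(2·√(−K)·(√(C − r² + s²) + s)) on the region where C − r² + s² > 0, √(C − r² + s²) + s > 0 and 0 < r. Then φ satisfies both equations: (i) φ_r − s·φ_{rs} − r·φ_{ss} = 0, and (ii) K·φ² = ψ² − (s·ψ_r + r·ψ_s)/r, where ψ := (s·φ_r + r·φ_s)/(2rφ). (Hence the spherically symmetric metric F = |y|·φ(|x|, ⟨x,y⟩/|y|) is projectively flat of constant flag curvature K.) -/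
open Real

/-- The first non-constant solution of the Shen–Yu classification:
φ = 1/(2√(−K)·(√(C − r² + s²) + s)). -/
noncomputable def sol1Phi (K C : ℝ) : ℝ → ℝ → ℝ :=
  fun r s => 1 / (2 * Real.sqrt (-K) * (Real.sqrt (C - r ^ 2 + s ^ 2) + s))

/-- The region on which `sol1Phi K C` is considered, away from the condition `0 < r`. -/
def sol1Domain (C : ℝ) (r s : ℝ) : Prop :=
  0 < C - r ^ 2 + s ^ 2 ∧ 0 < √(C - r ^ 2 + s ^ 2) + s

namespace sol1Domain

variable {C r s : ℝ}

lemma eventually_fst (h : sol1Domain C r s) : ∀ᶠ t in nhds r, sol1Domain C t s :=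
  (ContinuousAt.eventually_lt (g := fun t => C - t ^ 2 + s ^ 2) continuousAt_const
      (by fun_prop) h.1).and
    (ContinuousAt.eventually_lt (g := fun t => √(C - t ^ 2 + s ^ 2) + s) continuousAt_const
      (by fun_prop) h.2)

lemma eventually_snd (h : sol1Domain C r s) : ∀ᶠ t in nhds s, sol1Domain C r t :=
  (ContinuousAt.eventually_lt (g := fun t => C - r ^ 2 + t ^ 2) continuousAt_const
      (by fun_prop) h.1).and
    (ContinuousAt.eventually_lt (g := fun t => √(C - r ^ 2 + t ^ 2) + t) continuousAt_const
      (by fun_prop) h.2)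

lemma sqrt_pos (h : sol1Domain C r s) : 0 < √(C - r ^ 2 + s ^ 2) := Real.sqrt_pos.2 h.1

lemma hasDerivAt_sqrt_fst (h : sol1Domain C r s) :
    HasDerivAt (fun t => √(C - t ^ 2 + s ^ 2)) (-r / √(C - r ^ 2 + s ^ 2)) r := by
  have hu := h.sqrt_pos
  convert (((hasDerivAt_pow 2 r).const_sub C).add_const (s ^ 2)).sqrt h.1.ne' using 1
  field_simp
  simp [mul_comm]

lemma hasDerivAt_sqrt_snd (h : sol1Domain C r s) :
    HasDerivAt (fun t => √(C - r ^ 2 + t ^ 2)) (s / √(C - r ^ 2 + s ^ 2)) s := by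
  have hu := h.sqrt_pos
  convert ((hasDerivAt_pow 2 s).const_add (C - r ^ 2)).sqrt h.1.ne' using 1
  field_simp
  simp [mul_comm]

lemma pd1_sol1Phi {K : ℝ} (hK : K < 0) (h : sol1Domain C r s) :
    pd1 (sol1Phi K C) r s =
      r / (2 * √(-K) * √(C - r ^ 2 + s ^ 2) * (√(C - r ^ 2 + s ^ 2) + s) ^ 2) := by
  have hk : 0 < √(-K) := Real.sqrt_pos.2 (neg_pos.2 hK)
  have hu := h.sqrt_pos
  have hw := h.2
  have hd := (hasDerivAt_const r (1 : ℝ)).fun_div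
    ((h.hasDerivAt_sqrt_fst.add_const s).const_mul (2 * √(-K))) (by positivity)
  refine hd.deriv.trans ?_
  field_simp
  ring

lemma pd2_sol1Phi {K : ℝ} (hK : K < 0) (h : sol1Domain C r s) :
    pd2 (sol1Phi K C) r s =
      -1 / (2 * √(-K) * (√(C - r ^ 2 + s ^ 2) * (√(C - r ^ 2 + s ^ 2) + s))) := by
  have hk : 0 < √(-K) := Real.sqrt_pos.2 (neg_pos.2 hK)
  have hu := h.sqrt_pos
  have hw := h.2
  have hd := (hasDerivAt_const s (1 : ℝ)).fun_div
    ((h.hasDerivAt_sqrt_snd.fun_add (hasDerivAt_id' s)).const_mul (2 * √(-K))) (by positivity)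
  refine hd.deriv.trans ?_
  field_simp
  ring

lemma pd1_pd2_sol1Phi {K : ℝ} (hK : K < 0) (h : sol1Domain C r s) :
    pd1 (pd2 (sol1Phi K C)) r s =
      -r * (2 * √(C - r ^ 2 + s ^ 2) + s) /
        (2 * √(-K) * √(C - r ^ 2 + s ^ 2) ^ 3 * (√(C - r ^ 2 + s ^ 2) + s) ^ 2) := by
  have hk : 0 < √(-K) := Real.sqrt_pos.2 (neg_pos.2 hK)
  have hu := h.sqrt_pos
  have hw := h.2
  have hd := (hasDerivAt_const r (-1 : ℝ)).fun_div
    ((h.hasDerivAt_sqrt_fst.fun_mul (h.hasDerivAt_sqrt_fst.add_const s)).const_mul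
      (2 * √(-K))) (by positivity)
  have he : (fun t => pd2 (sol1Phi K C) t s) =ᶠ[nhds r] _ :=
    h.eventually_fst.mono fun t ht => ht.pd2_sol1Phi hK
  refine (he.deriv_eq.trans hd.deriv).trans ?_
  field_simp
  ring

lemma pd2_pd2_sol1Phi {K : ℝ} (hK : K < 0) (h : sol1Domain C r s) :
    pd2 (pd2 (sol1Phi K C)) r s = 1 / (2 * √(-K) * √(C - r ^ 2 + s ^ 2) ^ 3) := by
  have hk : 0 < √(-K) := Real.sqrt_pos.2 (neg_pos.2 hK)
  have hu := h.sqrt_pos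
  have hw := h.2
  have hd := (hasDerivAt_const s (-1 : ℝ)).fun_div
    ((h.hasDerivAt_sqrt_snd.fun_mul
      (h.hasDerivAt_sqrt_snd.fun_add (hasDerivAt_id' s))).const_mul (2 * √(-K))) (by positivity)
  have he : (fun t => pd2 (sol1Phi K C) r t) =ᶠ[nhds s] _ :=
    h.eventually_snd.mono fun t ht => ht.pd2_sol1Phi hK
  refine (he.deriv_eq.trans hd.deriv).trans ?_
  field_simp
  ring

lemma psiFun_sol1Phi {K : ℝ} (hK : K < 0) (hr : 0 < r) (h : sol1Domain C r s) :
    psiFun (sol1Phi K C) r s = -√(-K) * sol1Phi K C r s := by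
  have hk : 0 < √(-K) := Real.sqrt_pos.2 (neg_pos.2 hK)
  have hu := h.sqrt_pos
  have hw := h.2
  rw [psiFun, h.pd1_sol1Phi hK, h.pd2_sol1Phi hK, sol1Phi]
  field_simp
  ring

lemma pd1_psiFun_sol1Phi {K : ℝ} (hK : K < 0) (hr : 0 < r) (h : sol1Domain C r s) :
    pd1 (psiFun (sol1Phi K C)) r s = -√(-K) * pd1 (sol1Phi K C) r s := by
  have he : (fun t => psiFun (sol1Phi K C) t s) =ᶠ[nhds r] _ :=
    (h.eventually_fst.and (lt_mem_nhds hr)).mono fun t ht => ht.1.psiFun_sol1Phi hK ht.2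
  exact he.deriv_eq.trans (deriv_const_mul_field _)

lemma pd2_psiFun_sol1Phi {K : ℝ} (hK : K < 0) (hr : 0 < r) (h : sol1Domain C r s) :
    pd2 (psiFun (sol1Phi K C)) r s = -√(-K) * pd2 (sol1Phi K C) r s := by
  have he : (fun t => psiFun (sol1Phi K C) r t) =ᶠ[nhds s] _ :=
    h.eventually_snd.mono fun t ht => ht.psiFun_sol1Phi hK hr
  exact he.deriv_eq.trans (deriv_const_mul_field _)

end sol1Domain

theorem sol1_satisfies_PDEs (K C : ℝ) (hK : K < 0) (hC : 0 < C) :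
    ∀ r s : ℝ, 0 < r → 0 < C - r ^ 2 + s ^ 2 → 0 < Real.sqrt (C - r ^ 2 + s ^ 2) + s →
      (pd1 (sol1Phi K C) r s - s * pd1 (pd2 (sol1Phi K C)) r s
        - r * pd2 (pd2 (sol1Phi K C)) r s = 0) ∧
      (K * (sol1Phi K C r s) ^ 2 =
        (psiFun (sol1Phi K C) r s) ^ 2
          - (s * pd1 (psiFun (sol1Phi K C)) r s + r * pd2 (psiFun (sol1Phi K C)) r s) / r) := by
  intro r s hr hpos hw
  have h : sol1Domain C r s := ⟨hpos, hw⟩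
  have hk : 0 < √(-K) := Real.sqrt_pos.2 (neg_pos.2 hK)
  have hu := h.sqrt_pos
  constructor
  · rw [h.pd1_sol1Phi hK, h.pd1_pd2_sol1Phi hK, h.pd2_pd2_sol1Phi hK]
    field_simp
    ring
  · have hK' : K = -√(-K) ^ 2 := by rw [Real.sq_sqrt (neg_pos.2 hK).le, neg_neg]
    rw [h.psiFun_sol1Phi hK hr, h.pd1_psiFun_sol1Phi hK hr, h.pd2_psiFun_sol1Phi hK hr,
      h.pd1_sol1Phi hK, h.pd2_sol1Phi hK, sol1Phi]
    nth_rewrite 1 [hK']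
    field_simp
    ring
end

section
/- Let K, C, D be constants, let I ⊆ ℝ be an open interval, and let q: I → ℝ be a smooth nowhere-vanishing function satisfying D²·q(u)⁴ + (u − C)·q(u)² − K = 0 for all u ∈ I. Define φ(r,s) := q(r² − s²)/(q(r² − s²)²·(D·q(r² − s²) + s)² + K) on a region where r > 0, r² − s² ∈ I, the denominator q²(Dq + s)² + K is nonzero, and φ > 0. Then φ satisfies both: (i) φ_r − s·φ_{rs} − r·φ_{ss} = 0, and (ii) K·φ² = ψ² − (s·ψ_r + r·ψ_s)/r, where ψ := (s·φ_r + r·φ_s)/(2rφ). -/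
open Real

/-- The second family of non-constant solutions of the Shen–Yu classification:
φ = q/(q²(Dq + s)² + K) with q = q(r² − s²). -/
noncomputable def sol2Phi (K D : ℝ) (q : ℝ → ℝ) : ℝ → ℝ → ℝ :=
  fun r s => q (r ^ 2 - s ^ 2) /
    ((q (r ^ 2 - s ^ 2)) ^ 2 * (D * q (r ^ 2 - s ^ 2) + s) ^ 2 + K)

/-- The derivative of a solution of `D²q⁴ + (u − C)q² = K`, by implicit differentiation. -/
lemma hasDerivAt_of_quartic {K C D u : ℝ} {q : ℝ → ℝ} (hd : DifferentiableAt ℝ q u)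
    (hne : q u ≠ 0)
    (heq : ∀ᶠ v in nhds u, D ^ 2 * (q v) ^ 4 + (v - C) * (q v) ^ 2 - K = 0) :
    D ^ 2 * (q u) ^ 4 + K ≠ 0 ∧
      HasDerivAt q (-(q u) ^ 3 / (2 * (D ^ 2 * (q u) ^ 4 + K))) u := by
  have hq := hd.hasDerivAt
  have h1 := (((hq.pow 4).const_mul (D ^ 2)).add
    (((hasDerivAt_id u).sub_const C).mul (hq.pow 2))).sub_const K
  have h2 : HasDerivAt (fun v => D ^ 2 * (q v) ^ 4 + (v - C) * (q v) ^ 2 - K) 0 u :=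
    (hasDerivAt_const u (0 : ℝ)).congr_of_eventuallyEq heq
  have h3 := h1.unique h2
  simp only [id, Pi.pow_apply] at h3
  have h4 := heq.self_of_nhds
  have h5 : 2 * (D ^ 2 * (q u) ^ 4 + K) * deriv q u = -(q u) ^ 3 := by
    push_cast at h3
    linear_combination q u * h3 - 2 * deriv q u * h4
  have hE : D ^ 2 * (q u) ^ 4 + K ≠ 0 := by
    intro h0
    rw [h0] at h5
    exact hne (by simpa using h5.symm)
  refine ⟨hE, ?_⟩
  rwa [← h5, mul_div_cancel_left₀ _ (mul_ne_zero two_ne_zero hE)]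

section Composition

variable {f G : ℝ → ℝ → ℝ} {q : ℝ → ℝ} {q' GQ Gs r s : ℝ}

/-- First partial derivative of `G (q (r² − s²), s)`. -/
lemma pd1_comp_sq_sub_sq (hq : HasDerivAt q q' (r ^ 2 - s ^ 2))
    (hQ : HasDerivAt (fun Q => G Q s) GQ (q (r ^ 2 - s ^ 2)))
    (hf : ∀ᶠ p : ℝ × ℝ in nhds (r, s), f p.1 p.2 = G (q (p.1 ^ 2 - p.2 ^ 2)) p.2) :
    pd1 f r s = 2 * r * q' * GQ := by
  have hu : HasDerivAt (fun t : ℝ => t ^ 2 - s ^ 2) (2 * r) r := by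
    simpa using (hasDerivAt_pow 2 r).sub_const (s ^ 2)
  have hev : (fun t => f t s) =ᶠ[nhds r] fun t => G (q (t ^ 2 - s ^ 2)) s :=
    (Continuous.prodMk_left s).continuousAt.eventually hf
  have h := (hQ.comp r (HasDerivAt.comp r hq hu)).congr_of_eventuallyEq hev
  rw [pd1, h.deriv]
  ring

/-- Second partial derivative of `G (q (r² − s²), s)`. -/
lemma pd2_comp_sq_sub_sq (hq : HasDerivAt q q' (r ^ 2 - s ^ 2))
    (hG : DifferentiableAt ℝ (Function.uncurry G) (q (r ^ 2 - s ^ 2), s))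
    (hQ : HasDerivAt (fun Q => G Q s) GQ (q (r ^ 2 - s ^ 2)))
    (hs : HasDerivAt (G (q (r ^ 2 - s ^ 2))) Gs s)
    (hf : ∀ᶠ p : ℝ × ℝ in nhds (r, s), f p.1 p.2 = G (q (p.1 ^ 2 - p.2 ^ 2)) p.2) :
    pd2 f r s = -2 * s * q' * GQ + Gs := by
  have hu : HasDerivAt (fun t : ℝ => r ^ 2 - t ^ 2) (-(2 * s)) s := by
    simpa using (hasDerivAt_pow 2 s).const_sub (r ^ 2)
  have hev : (fun t => f r t) =ᶠ[nhds s] fun t => G (q (r ^ 2 - t ^ 2)) t :=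
    (Continuous.prodMk_right r).continuousAt.eventually hf
  set L := fderiv ℝ (Function.uncurry G) (q (r ^ 2 - s ^ 2), s)
  have hF : HasFDerivAt (Function.uncurry G) L (q (r ^ 2 - s ^ 2), s) := hG.hasFDerivAt
  have e1 : L (1, 0) = GQ :=
    (hF.comp_hasDerivAt (q (r ^ 2 - s ^ 2)) (f := fun Q => (Q, s))
      ((hasDerivAt_id _).prodMk (hasDerivAt_const _ s))).unique hQ
  have e2 : L (0, 1) = Gs :=
    (hF.comp_hasDerivAt s (f := fun t => (q (r ^ 2 - s ^ 2), t))
      ((hasDerivAt_const s _).prodMk (hasDerivAt_id _))).unique hs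
  have h := (hF.comp_hasDerivAt s (f := fun t => (q (r ^ 2 - t ^ 2), t))
    ((HasDerivAt.comp s hq hu).prodMk (hasDerivAt_id s))).congr_of_eventuallyEq hev
  have e3 : ((q' * -(2 * s), 1) : ℝ × ℝ)
      = (q' * -(2 * s)) • ((1, 0) : ℝ × ℝ) + ((0, 1) : ℝ × ℝ) := by
    simp
  rw [pd2, h.deriv, e3, map_add, map_smul, e1, e2, smul_eq_mul]
  ring

/-- The field `s ∂_r + r ∂_s` annihilates `r² − s²`, so only the explicit dependence on `s`
contributes. -/
lemma rotation_comp_sq_sub_sq (hq : HasDerivAt q q' (r ^ 2 - s ^ 2))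
    (hG : DifferentiableAt ℝ (Function.uncurry G) (q (r ^ 2 - s ^ 2), s))
    (hs : HasDerivAt (G (q (r ^ 2 - s ^ 2))) Gs s)
    (hf : ∀ᶠ p : ℝ × ℝ in nhds (r, s), f p.1 p.2 = G (q (p.1 ^ 2 - p.2 ^ 2)) p.2) :
    s * pd1 f r s + r * pd2 f r s = r * Gs := by
  have hQ : HasDerivAt (fun Q => G Q s) _ (q (r ^ 2 - s ^ 2)) :=
    hG.hasFDerivAt.comp_hasDerivAt (q (r ^ 2 - s ^ 2)) (f := fun Q => (Q, s))
      ((hasDerivAt_id _).prodMk (hasDerivAt_const _ s))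
  rw [pd1_comp_sq_sub_sq hq hQ hf, pd2_comp_sq_sub_sq hq hG hQ hs hf]
  ring

end Composition

section Profile

variable {K D Q s : ℝ}

lemma hasDerivAt_den_fst :
    HasDerivAt (fun Q => Q ^ 2 * (D * Q + s) ^ 2 + K)
      (2 * Q * (D * Q + s) ^ 2 + 2 * D * Q ^ 2 * (D * Q + s)) Q := by
  have h := (((hasDerivAt_pow 2 Q).mul
    ((((hasDerivAt_id Q).const_mul D).add_const s).pow 2)).add_const K)
  refine h.congr_deriv ?_
  simp
  ring

lemma hasDerivAt_den_snd :
    HasDerivAt (fun s => Q ^ 2 * (D * Q + s) ^ 2 + K) (2 * Q ^ 2 * (D * Q + s)) s := by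
  have h := ((((hasDerivAt_id s).const_add (D * Q)).pow 2).const_mul (Q ^ 2)).add_const K
  refine h.congr_deriv ?_
  simp
  ring

lemma hasDerivAt_profile_fst (hN : Q ^ 2 * (D * Q + s) ^ 2 + K ≠ 0) :
    HasDerivAt (fun Q => Q / (Q ^ 2 * (D * Q + s) ^ 2 + K))
      ((K - Q ^ 2 * (D * Q + s) ^ 2 - 2 * D * Q ^ 3 * (D * Q + s)) /
        (Q ^ 2 * (D * Q + s) ^ 2 + K) ^ 2) Q := by
  refine ((hasDerivAt_id Q).div hasDerivAt_den_fst hN).congr_deriv ?_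
  simp only [id]
  ring

lemma hasDerivAt_profile_snd (hN : Q ^ 2 * (D * Q + s) ^ 2 + K ≠ 0) :
    HasDerivAt (fun s => Q / (Q ^ 2 * (D * Q + s) ^ 2 + K))
      (-2 * Q ^ 3 * (D * Q + s) / (Q ^ 2 * (D * Q + s) ^ 2 + K) ^ 2) s := by
  refine ((hasDerivAt_const s Q).div hasDerivAt_den_snd hN).congr_deriv ?_
  ring

/-- The derivative of `ψ = −Q²(DQ + s)/(Q²(DQ + s)² + K)` in `s`. -/
lemma hasDerivAt_psi_profile (hN : Q ^ 2 * (D * Q + s) ^ 2 + K ≠ 0) :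
    HasDerivAt (fun s => -Q ^ 2 * (D * Q + s) / (Q ^ 2 * (D * Q + s) ^ 2 + K))
      ((Q ^ 4 * (D * Q + s) ^ 2 - K * Q ^ 2) / (Q ^ 2 * (D * Q + s) ^ 2 + K) ^ 2) s := by
  have h := (((hasDerivAt_id s).const_add (D * Q)).const_mul (-Q ^ 2)).div hasDerivAt_den_snd hN
  refine h.congr_deriv ?_
  simp only [id]
  ring

/-- The partial derivative `φ_s`, as a function of `Q = q (r² − s²)` and `s`. -/
noncomputable def sol2PhiS (K D Q s : ℝ) : ℝ :=
  -2 * s * (-Q ^ 3 / (2 * (D ^ 2 * Q ^ 4 + K))) *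
    ((K - Q ^ 2 * (D * Q + s) ^ 2 - 2 * D * Q ^ 3 * (D * Q + s)) /
      (Q ^ 2 * (D * Q + s) ^ 2 + K) ^ 2) +
    -2 * Q ^ 3 * (D * Q + s) / (Q ^ 2 * (D * Q + s) ^ 2 + K) ^ 2

lemma differentiableAt_sol2PhiS (hN : Q ^ 2 * (D * Q + s) ^ 2 + K ≠ 0)
    (hE : D ^ 2 * Q ^ 4 + K ≠ 0) :
    DifferentiableAt ℝ (Function.uncurry (sol2PhiS K D)) (Q, s) := by
  unfold sol2PhiS Function.uncurry
  fun_prop (disch := simp [hN, hE])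

lemma hasDerivAt_sol2PhiS (hN : Q ^ 2 * (D * Q + s) ^ 2 + K ≠ 0) (hE : D ^ 2 * Q ^ 4 + K ≠ 0) :
    HasDerivAt (sol2PhiS K D Q)
      (2 * (-Q ^ 3 / (2 * (D ^ 2 * Q ^ 4 + K))) *
        ((K - Q ^ 2 * (D * Q + s) ^ 2 - 2 * D * Q ^ 3 * (D * Q + s)) /
          (Q ^ 2 * (D * Q + s) ^ 2 + K) ^ 2)) s := by
  have hl : HasDerivAt (fun s => D * Q + s) 1 s := (hasDerivAt_id s).const_add _
  have hN2 : HasDerivAt (fun s => (Q ^ 2 * (D * Q + s) ^ 2 + K) ^ 2)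
      (2 * (Q ^ 2 * (D * Q + s) ^ 2 + K) * (2 * Q ^ 2 * (D * Q + s))) s :=
    ((hasDerivAt_den_snd (K := K) (D := D) (Q := Q) (s := s)).pow 2).congr_deriv (by simp)
  have hA : HasDerivAt
      (fun s => K - Q ^ 2 * (D * Q + s) ^ 2 - 2 * D * Q ^ 3 * (D * Q + s))
      (-(2 * Q ^ 2 * (D * Q + s)) - 2 * D * Q ^ 3) s := by
    refine ((((hl.pow 2).const_mul (Q ^ 2)).const_sub K).sub
      (hl.const_mul (2 * D * Q ^ 3))).congr_deriv ?_
    simp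
    ring
  have hB : HasDerivAt (fun s => -2 * s * (-Q ^ 3 / (2 * (D ^ 2 * Q ^ 4 + K))))
      (-2 * (-Q ^ 3 / (2 * (D ^ 2 * Q ^ 4 + K)))) s :=
    (((hasDerivAt_id s).const_mul (-2)).mul_const _).congr_deriv (by simp)
  have h := (hB.mul (hA.div hN2 (pow_ne_zero 2 hN))).add
    ((hl.const_mul (-2 * Q ^ 3)).div hN2 (pow_ne_zero 2 hN))
  refine h.congr_deriv ?_
  simp only [Pi.div_apply]
  generalize hNdef : Q ^ 2 * (D * Q + s) ^ 2 + K = N at hN ⊢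
  generalize hEdef : D ^ 2 * Q ^ 4 + K = E at hE ⊢
  field_simp
  subst hNdef hEdef
  ring

end Profile

theorem sol2_satisfies_PDEs (K C D a b : ℝ) (q : ℝ → ℝ)
    (hq : ContDiffOn ℝ (⊤ : ℕ∞) q (Set.Ioo a b))
    (hqne : ∀ u ∈ Set.Ioo a b, q u ≠ 0)
    (hqeq : ∀ u ∈ Set.Ioo a b, D ^ 2 * (q u) ^ 4 + (u - C) * (q u) ^ 2 - K = 0)
    (U : Set (ℝ × ℝ)) (hU : IsOpen U)
    (hreg : ∀ p ∈ U, 0 < p.1 ∧ p.1 ^ 2 - p.2 ^ 2 ∈ Set.Ioo a b ∧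
      (q (p.1 ^ 2 - p.2 ^ 2)) ^ 2 * (D * q (p.1 ^ 2 - p.2 ^ 2) + p.2) ^ 2 + K ≠ 0 ∧
      0 < sol2Phi K D q p.1 p.2) :
    ∀ p ∈ U,
      (pd1 (sol2Phi K D q) p.1 p.2 - p.2 * pd1 (pd2 (sol2Phi K D q)) p.1 p.2
        - p.1 * pd2 (pd2 (sol2Phi K D q)) p.1 p.2 = 0) ∧
      (K * (sol2Phi K D q p.1 p.2) ^ 2 =
        (psiFun (sol2Phi K D q) p.1 p.2) ^ 2
          - (p.2 * pd1 (psiFun (sol2Phi K D q)) p.1 p.2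
            + p.1 * pd2 (psiFun (sol2Phi K D q)) p.1 p.2) / p.1) := by
  have hN : ∀ p ∈ U,
      (q (p.1 ^ 2 - p.2 ^ 2)) ^ 2 * (D * q (p.1 ^ 2 - p.2 ^ 2) + p.2) ^ 2 + K ≠ 0 :=
    fun p hp => (hreg p hp).2.2.1
  have hder : ∀ p ∈ U, D ^ 2 * (q (p.1 ^ 2 - p.2 ^ 2)) ^ 4 + K ≠ 0 ∧
      HasDerivAt q (-(q (p.1 ^ 2 - p.2 ^ 2)) ^ 3 /
        (2 * (D ^ 2 * (q (p.1 ^ 2 - p.2 ^ 2)) ^ 4 + K))) (p.1 ^ 2 - p.2 ^ 2) := by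
    intro p hp
    have hu := (hreg p hp).2.1
    have hnhds := Ioo_mem_nhds hu.1 hu.2
    exact hasDerivAt_of_quartic ((hq.contDiffAt hnhds).differentiableAt (by simp))
      (hqne _ hu) (Filter.eventually_of_mem hnhds hqeq)
  let G : ℝ → ℝ → ℝ := fun Q s => Q / (Q ^ 2 * (D * Q + s) ^ 2 + K)
  have hGdiff : ∀ p ∈ U,
      DifferentiableAt ℝ (Function.uncurry G) (q (p.1 ^ 2 - p.2 ^ 2), p.2) := by
    intro p hp
    have := hN p hp
    unfold G Function.uncurry
    fun_prop (disch := simpa using this)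
  have hφ : ∀ p : ℝ × ℝ, ∀ᶠ x in nhds (p.1, p.2),
      sol2Phi K D q x.1 x.2 = G (q (x.1 ^ 2 - x.2 ^ 2)) x.2 :=
    fun p => Filter.Eventually.of_forall fun _ => rfl
  have hφs : ∀ p ∈ U, pd2 (sol2Phi K D q) p.1 p.2 = sol2PhiS K D (q (p.1 ^ 2 - p.2 ^ 2)) p.2 :=
    fun p hp => pd2_comp_sq_sub_sq (hder p hp).2 (hGdiff p hp)
      (hasDerivAt_profile_fst (hN p hp)) (hasDerivAt_profile_snd (hN p hp)) (hφ p)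
  have hψ : ∀ p ∈ U, psiFun (sol2Phi K D q) p.1 p.2 =
      -(q (p.1 ^ 2 - p.2 ^ 2)) ^ 2 * (D * q (p.1 ^ 2 - p.2 ^ 2) + p.2) /
        ((q (p.1 ^ 2 - p.2 ^ 2)) ^ 2 * (D * q (p.1 ^ 2 - p.2 ^ 2) + p.2) ^ 2 + K) := by
    intro p hp
    have hr := (hreg p hp).1.ne'
    have hNp := hN p hp
    have hQ := hqne _ (hreg p hp).2.1
    rw [psiFun, rotation_comp_sq_sub_sq (hder p hp).2 (hGdiff p hp)
      (hasDerivAt_profile_snd hNp) (hφ p), sol2Phi]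
    field_simp
  intro p hp
  have hUp : ∀ᶠ x in nhds (p.1, p.2), x ∈ U := hU.mem_nhds hp
  have hr := (hreg p hp).1.ne'
  have hNp := hN p hp
  obtain ⟨hE, hq'⟩ := hder p hp
  constructor
  · have h := rotation_comp_sq_sub_sq hq' (differentiableAt_sol2PhiS hNp hE)
      (hasDerivAt_sol2PhiS hNp hE) (hUp.mono hφs)
    rw [sub_sub, h, pd1_comp_sq_sub_sq hq' (hasDerivAt_profile_fst hNp) (hφ p)]
    ring
  · have hdiff : DifferentiableAt ℝ (Function.uncurry fun Q s =>
        -Q ^ 2 * (D * Q + s) / (Q ^ 2 * (D * Q + s) ^ 2 + K)) (q (p.1 ^ 2 - p.2 ^ 2), p.2) := by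
      unfold Function.uncurry
      fun_prop (disch := simpa using hNp)
    rw [rotation_comp_sq_sub_sq hq' hdiff (hasDerivAt_psi_profile hNp) (hUp.mono hψ),
      hψ p hp, sol2Phi]
    field_simp
    ring
end

section
/- Let n ≥ 3, let y, v ∈ ℝⁿ with y ≠ 0 and v ≠ 0, and let a, c ∈ ℝ. If a·v_i·v_j = c·(|y|²·δ_{ij} − y_i·y_j) for all indices 1 ≤ i, j ≤ n (where |y| is the Euclidean norm and δ_{ij} the Kronecker delta), then a = 0 and c = 0. -/
/-- In an inner product space of dimension at least three, some nonzero vector is orthogonal to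
two given vectors. -/
theorem exists_ne_zero_inner_eq_zero_of_two_lt_finrank {E : Type*} [NormedAddCommGroup E]
    [InnerProductSpace ℝ E] [FiniteDimensional ℝ E] (hE : 2 < Module.finrank ℝ E) (u v : E) :
    ∃ w : E, w ≠ 0 ∧ inner ℝ u w = 0 ∧ inner ℝ v w = 0 := by
  classical
  have hlt : Module.finrank ℝ (Submodule.span ℝ {u, v}) < Module.finrank ℝ E := by
    have hle := finrank_span_finset_le_card (R := ℝ) ({u, v} : Finset E)
    rw [Set.finrank, Finset.coe_pair] at hle
    exact (hle.trans Finset.card_le_two).trans_lt hE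
  have hbot : (Submodule.span ℝ {u, v})ᗮ ≠ ⊥ := by
    rw [Ne, Submodule.orthogonal_eq_bot_iff]
    intro htop
    rw [htop, finrank_top] at hlt
    exact hlt.false
  obtain ⟨w, hw, hw0⟩ := Submodule.exists_mem_ne_zero_of_ne_bot hbot
  rw [Submodule.mem_orthogonal] at hw
  exact ⟨w, hw0, hw u (Submodule.subset_span (by simp)), hw v (Submodule.subset_span (by simp))⟩

/-- Linear-algebra kernel of Lemma 2.5: for n ≥ 3 and nonzero y, v ∈ ℝⁿ, if
a·vᵢ·vⱼ = c·(|y|²δᵢⱼ − yᵢyⱼ) for all i, j, then a = 0 and c = 0. -/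
theorem rank_one_eq_rank_n_sub_one_implies_zero (n : ℕ) (hn : 3 ≤ n)
    (y v : EuclideanSpace ℝ (Fin n)) (hy : y ≠ 0) (hv : v ≠ 0) (a c : ℝ)
    (h : ∀ i j : Fin n,
      a * v i * v j = c * (‖y‖ ^ 2 * (if i = j then (1 : ℝ) else 0) - y i * y j)) :
    a = 0 ∧ c = 0 := by
  have ne_zero_coord : ∀ {x : EuclideanSpace ℝ (Fin n)}, x ≠ 0 → ∃ i, x i ≠ 0 := by
    intro x hx
    by_contra! hzero
    exact hx (PiLp.ext hzero)
  obtain ⟨w, hw, hyw, hvw⟩ :=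
    exists_ne_zero_inner_eq_zero_of_two_lt_finrank (by rw [finrank_euclideanSpace_fin]; omega) y v
  simp only [PiLp.inner_apply, RCLike.inner_apply, conj_trivial] at hyw hvw
  obtain ⟨i, hi⟩ := ne_zero_coord hw
  have hc : c = 0 := by
    have hsum : ∑ j, a * v i * v j * w j =
        ∑ j, c * (‖y‖ ^ 2 * (if i = j then (1 : ℝ) else 0) - y i * y j) * w j :=
      Finset.sum_congr rfl fun j _ => by rw [h i j]
    have hleft : ∑ j, a * v i * v j * w j = a * v i * ∑ j, w j * v j := by
      rw [Finset.mul_sum]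
      exact Finset.sum_congr rfl fun j _ => by ring
    have hright : ∑ j, c * (‖y‖ ^ 2 * (if i = j then (1 : ℝ) else 0) - y i * y j) * w j =
        c * ‖y‖ ^ 2 * w i - c * y i * ∑ j, w j * y j := by
      have hwi : w i = ∑ j, (if i = j then (1 : ℝ) else 0) * w j := by simp
      rw [hwi, Finset.mul_sum, Finset.mul_sum, ← Finset.sum_sub_distrib]
      exact Finset.sum_congr rfl fun j _ => by ring
    rw [hleft, hright, hyw, hvw] at hsum
    simpa [hi, hy] using hsum.symm
  obtain ⟨k, hk⟩ := ne_zero_coord hv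
  refine ⟨?_, hc⟩
  simpa [hc, hk] using h k k
end
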